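/- For every integer n ≥ 1 there exist constants δ₀ > 0 and C > 0 such that the following holds: for every ε > 0, every r > 0, and every smooth u : ℝ² → ℝ^{n+1} satisfying −Δu = (1/ε²)(1−|u|²)u on the open ball B_r, if ∫_{B_r} e_ε(u) < δ₀, then for every x ∈ B_{r/2} one has r²·(|Du(x)|² + (1/ε²)(1−|u(x)|²)²) ≤ C ∫_{B_r} e_ε(u). -/

import Mathlib

open MeasureTheory Metric Real

noncomputable section

/-- Euclidean plane. -/
abbrev E2 : Type := EuclideanSpace ℝ (Fin 2)

/-- Partial derivative in the `k`-th coordinate direction. -/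
def pd {F : Type} [NormedAddCommGroup F] [NormedSpace ℝ F]
    (k : Fin 2) (f : E2 → F) (x : E2) : F :=
  fderiv ℝ f x (EuclideanSpace.single k 1)

/-- Euclidean Laplacian, acting componentwise. -/
def lap {F : Type} [NormedAddCommGroup F] [NormedSpace ℝ F]
    (f : E2 → F) (x : E2) : F :=
  pd 0 (pd 0 f) x + pd 1 (pd 1 f) x

/-- Squared Frobenius norm of the total derivative. -/
def gradSqNorm {F : Type} [NormedAddCommGroup F] [NormedSpace ℝ F]
    (f : E2 → F) (x : E2) : ℝ :=
  ∑ k : Fin 2, ‖pd k f x‖ ^ 2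

/-- Ginzburg–Landau energy density `e_ε(u) = ½|Du|² + (1−|u|²)²/(4ε²)`. -/
def eDens {F : Type} [NormedAddCommGroup F] [NormedSpace ℝ F]
    (ε : ℝ) (f : E2 → F) (x : E2) : ℝ :=
  gradSqNorm f x / 2 + (1 - ‖f x‖ ^ 2) ^ 2 / (4 * ε ^ 2)

section Bochner
variable {F : Type} [NormedAddCommGroup F] [InnerProductSpace ℝ F]

lemma pd_contDiff {F : Type} [NormedAddCommGroup F] [NormedSpace ℝ F] (k : Fin 2) {f : E2 → F}
    (hf : ContDiff ℝ (⊤ : ℕ∞) f) :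
    ContDiff ℝ (⊤ : ℕ∞) (pd k f) := by
  unfold pd
  exact (hf.fderiv_right (m := (⊤ : ℕ∞)) (by simp)).clm_apply contDiff_const

lemma pd_inner (k : Fin 2) {f g : E2 → F} (hf : ContDiff ℝ (⊤ : ℕ∞) f)
    (hg : ContDiff ℝ (⊤ : ℕ∞) g) (x : E2) :
    pd k (fun y => inner ℝ (f y) (g y)) x
      = inner ℝ (f x) (pd k g x) + inner ℝ (pd k f x) (g x) := by
  unfold pd
  exact fderiv_inner_apply ℝ (hf.differentiable (by simp) x) (hg.differentiable (by simp) x) _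

lemma pd_add {F : Type} [NormedAddCommGroup F] [NormedSpace ℝ F] (k : Fin 2) {f g : E2 → F}
    (hf : ContDiff ℝ (⊤ : ℕ∞) f)
    (hg : ContDiff ℝ (⊤ : ℕ∞) g) (x : E2) :
    pd k (fun y => f y + g y) x = pd k f x + pd k g x := by
  unfold pd
  rw [fderiv_fun_add (hf.differentiable (by simp) x) (hg.differentiable (by simp) x)]
  rfl

lemma pd_smul (k : Fin 2) {c : E2 → ℝ} {f : E2 → F} (hc : ContDiff ℝ (⊤ : ℕ∞) c)
    (hf : ContDiff ℝ (⊤ : ℕ∞) f) (x : E2) :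
    pd k (fun y => c y • f y) x = c x • pd k f x + pd k c x • f x := by
  unfold pd
  rw [fderiv_fun_smul (hc.differentiable (by simp) x) (hf.differentiable (by simp) x)]
  simp

lemma pd_const_smul (k : Fin 2) (c : ℝ) {f : E2 → F} 
    (hf : ContDiff ℝ (⊤ : ℕ∞) f) (x : E2) :
    pd k (fun y => c • f y) x = c • pd k f x := by
  unfold pd
  rw [fderiv_fun_const_smul (hf.differentiable (by simp) x)]
  simp

lemma csm (c : ℝ) {f : E2 → F} (hf : ContDiff ℝ (⊤ : ℕ∞) f) :
    ContDiff ℝ (⊤ : ℕ∞) (fun y => c • f y) := contDiff_const.fun_smul hf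

lemma pd_comm {F : Type} [NormedAddCommGroup F] [NormedSpace ℝ F] (j k : Fin 2) {f : E2 → F}
    (hf : ContDiff ℝ (⊤ : ℕ∞) f) (x : E2) :
    pd j (pd k f) x = pd k (pd j f) x := by
  have hs : IsSymmSndFDerivAt ℝ f x :=
    hf.contDiffAt.isSymmSndFDerivAt (by
      rw [minSmoothness_of_isRCLikeNormedField]; exact WithTop.coe_le_coe.2 le_top)
  have hd : DifferentiableAt ℝ (fderiv ℝ f) x :=
    (hf.fderiv_right (m := (⊤ : ℕ∞)) (by simp)).differentiable (by simp) x
  have key : ∀ a b : Fin 2, pd a (pd b f) x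
      = fderiv ℝ (fderiv ℝ f) x (EuclideanSpace.single a 1) (EuclideanSpace.single b 1) := by
    intro a b
    unfold pd
    rw [fderiv_clm_apply hd (differentiableAt_const _)]
    simp
  rw [key, key]
  exact hs _ _

lemma pd_congr {F : Type} [NormedAddCommGroup F] [NormedSpace ℝ F] (k : Fin 2) {f g : E2 → F}
    {x : E2} (h : f =ᶠ[nhds x] g) : pd k f x = pd k g x := by
  unfold pd; rw [h.fderiv_eq]

/-- second derivative of the squared norm -/
lemma pd_pd_normSq (k : Fin 2) {f : E2 → F} (hf : ContDiff ℝ (⊤ : ℕ∞) f) (x : E2) :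
    pd k (pd k (fun y => ‖f y‖ ^ 2)) x
      = 2 * inner ℝ (f x) (pd k (pd k f) x) + 2 * ‖pd k f x‖ ^ 2 := by
  have h1 : pd k (fun y => ‖f y‖ ^ 2) = fun y => (2 : ℝ) • inner ℝ (f y) (pd k f y) := by
    funext y
    have : (fun y => ‖f y‖ ^ 2) = fun y => inner ℝ (f y) (f y) := by
      funext z; rw [real_inner_self_eq_norm_sq]
    rw [this, pd_inner k hf hf, real_inner_comm (f y) (pd k f y), smul_eq_mul]; ring
  rw [h1, pd_const_smul k 2 (hf.inner ℝ (pd_contDiff k hf)), pd_inner k hf (pd_contDiff k hf),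
    real_inner_self_eq_norm_sq, smul_eq_mul]
  ring

lemma lap_normSq {f : E2 → F} (hf : ContDiff ℝ (⊤ : ℕ∞) f) (x : E2) :
    lap (fun y => ‖f y‖ ^ 2) x
      = 2 * inner ℝ (f x) (lap f x) + 2 * gradSqNorm f x := by
  unfold lap gradSqNorm
  rw [pd_pd_normSq 0 hf, pd_pd_normSq 1 hf, inner_add_right, Fin.sum_univ_two]
  ring

lemma lap_add {f g : E2 → F} (hf : ContDiff ℝ (⊤ : ℕ∞) f)
    (hg : ContDiff ℝ (⊤ : ℕ∞) g) (x : E2) :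
    lap (fun y => f y + g y) x = lap f x + lap g x := by
  have h : ∀ k : Fin 2, pd k (pd k (fun y => f y + g y)) x = pd k (pd k f) x + pd k (pd k g) x := by
    intro k
    rw [show pd k (fun y => f y + g y) = fun y => pd k f y + pd k g y from
      funext fun y => pd_add k hf hg y]
    exact pd_add k (pd_contDiff k hf) (pd_contDiff k hg) x
  unfold lap
  rw [h, h]; abel

lemma lap_const_smul (c : ℝ) {f : E2 → F} (hf : ContDiff ℝ (⊤ : ℕ∞) f) (x : E2) :
    lap (fun y => c • f y) x = c • lap f x := by
  have h : ∀ k : Fin 2, pd k (pd k (fun y => c • f y)) x = c • pd k (pd k f) x := by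
    intro k
    rw [show pd k (fun y => c • f y) = fun y => c • pd k f y from
      funext fun y => pd_const_smul k c hf y]
    exact pd_const_smul k c (pd_contDiff k hf) x
  unfold lap
  rw [h, h, smul_add]

lemma lap_pd (k : Fin 2) {f : E2 → F} (hf : ContDiff ℝ (⊤ : ℕ∞) f) (x : E2) :
    lap (pd k f) x = pd k (lap f) x := by
  have h : ∀ j : Fin 2, pd j (pd j (pd k f)) x = pd k (pd j (pd j f)) x := by
    intro j
    rw [show pd j (pd k f) = pd k (pd j f) from funext fun y => pd_comm j k hf y]
    exact pd_comm j k (pd_contDiff j hf) x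
  unfold lap
  rw [h, h, ← pd_add k (pd_contDiff 0 (pd_contDiff 0 hf)) (pd_contDiff 1 (pd_contDiff 1 hf))]

lemma algebra_core (a ρ G U e : ℝ) (ha : 0 ≤ a) (hG : 0 ≤ G) (hU : 0 ≤ U) (hρ : ρ = 1 - U)
    (he : e = G / 2 + a * ρ ^ 2 / 4) :
    -(32 * e ^ 2) ≤ -(2 * a * ρ * G) + a ^ 2 * ρ ^ 2 * U := by
  have hW : 0 ≤ a * ρ ^ 2 := by positivity
  by_cases h : 1 / 4 ≤ U
  · have h1 : 8 * G ^ 2 ≤ 32 * e ^ 2 := by rw [he]; nlinarith [mul_nonneg hG hW]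
    have h2 : a ^ 2 * ρ ^ 2 * (1 / 4) ≤ a ^ 2 * ρ ^ 2 * U :=
      mul_le_mul_of_nonneg_left h (by positivity)
    nlinarith [sq_nonneg (a * ρ / 2 - 2 * G), sq_nonneg G]
  · have h1 : 8 * (G * (a * ρ ^ 2)) ≤ 32 * e ^ 2 := by
      rw [he]; nlinarith [sq_nonneg (G / 2 - a * ρ ^ 2 / 4)]
    have h2 : 0 ≤ a * G * (ρ * (ρ - 3 / 4)) := by
      apply mul_nonneg (by positivity)
      apply mul_nonneg <;> linarith
    have h3 : 0 ≤ a ^ 2 * ρ ^ 2 * U := by positivity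
    have h4 : 0 ≤ a * G * ρ := mul_nonneg (by positivity) (by linarith)
    nlinarith

lemma eDens_contDiff (ε : ℝ) {u : E2 → F} (hu : ContDiff ℝ (⊤ : ℕ∞) u) :
    ContDiff ℝ (⊤ : ℕ∞) (eDens ε u) := by
  unfold eDens gradSqNorm
  apply ContDiff.add
  · apply ContDiff.div_const
    exact ContDiff.sum fun k _ => (pd_contDiff k hu).norm_sq ℝ
  · exact ((contDiff_const.sub (hu.norm_sq ℝ)).pow 2).div_const _

lemma eDens_nonneg (ε : ℝ) (u : E2 → F) (x : E2) : 0 ≤ eDens ε u x := by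
  unfold eDens gradSqNorm; positivity

lemma bochner (ε : ℝ) (hε : 0 < ε) {u : E2 → F} (hu : ContDiff ℝ (⊤ : ℕ∞) u) (x : E2)
    (hx : ∀ᶠ y in nhds x, -lap u y = ((1 / ε ^ 2) * (1 - ‖u y‖ ^ 2)) • u y) :
    -(32 * eDens ε u x ^ 2) ≤ lap (eDens ε u) x := by
  set a : ℝ := 1 / ε ^ 2 with ha
  have ha0 : 0 ≤ a := by positivity
  set ρ : E2 → ℝ := fun y => 1 + (-1 : ℝ) • ‖u y‖ ^ 2 with hρ
  have hns : ContDiff ℝ (⊤ : ℕ∞) (fun y => ‖u y‖ ^ 2) := hu.norm_sq ℝ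
  have hρc : ContDiff ℝ (⊤ : ℕ∞) ρ := contDiff_const.add (csm _ hns)
  -- derivative of rho
  have hpdρ : ∀ k y, pd k ρ y = -(2 * inner ℝ (u y) (pd k u y)) := by
    intro k y
    rw [hρ, pd_add k contDiff_const (csm _ hns), pd_const_smul k (-1) hns]
    have : (fun y => ‖u y‖ ^ 2) = fun y => inner ℝ (u y) (u y) := by
      funext z; rw [real_inner_self_eq_norm_sq]
    rw [this, pd_inner k hu hu, real_inner_comm (u y) (pd k u y), smul_eq_mul]
    simp [pd]; ring
  have hlapu : lap u x = -(a * ρ x) • u x := by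
    have := hx.self_of_nhds
    rw [neg_smul, hρ]
    rw [← neg_eq_iff_eq_neg, this]; simp [sub_eq_add_neg]
  have hone : lap (fun _ : E2 => (1 : ℝ)) x = 0 := by
    have : ∀ k, pd k (fun _ : E2 => (1 : ℝ)) = fun _ => 0 := by
      intro k; funext y; simp [pd]
    unfold lap
    rw [this, this]; simp [pd]
  have hlapρ : lap ρ x = -(2 * gradSqNorm u x) + 2 * a * ρ x * ‖u x‖ ^ 2 := by
    rw [hρ, lap_add contDiff_const (csm _ hns), lap_const_smul (-1) hns,
      lap_normSq hu, hlapu, inner_smul_right, real_inner_self_eq_norm_sq, hone, smul_eq_mul]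
    ring
  -- Laplacian of first derivatives
  have hlapp : ∀ k, inner ℝ (pd k u x) (lap (pd k u) x)
      = -(a * ρ x * ‖pd k u x‖ ^ 2) + a / 2 * (pd k ρ x) ^ 2 := by
    intro k
    have e1 : lap u =ᶠ[nhds x] fun y => (-a) • (ρ y • u y) := by
      filter_upwards [hx] with y hy
      rw [← neg_neg (lap u y), hy, smul_smul, ← neg_smul, hρ]
      simp [sub_eq_add_neg]
    rw [lap_pd k hu, pd_congr k e1, pd_const_smul k (-a) (hρc.fun_smul hu), pd_smul k hρc hu,
      inner_smul_right, inner_add_right, inner_smul_right, inner_smul_right,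
      real_inner_self_eq_norm_sq, real_inner_comm, hpdρ]
    ring
  -- decompose e
  have hdec : eDens ε u = fun y => ((1 / 2 : ℝ) • ‖pd 0 u y‖ ^ 2 + (1 / 2 : ℝ) • ‖pd 1 u y‖ ^ 2)
      + (a / 4) • ‖ρ y‖ ^ 2 := by
    funext y
    simp only [eDens, gradSqNorm, Fin.sum_univ_two, smul_eq_mul, Real.norm_eq_abs, sq_abs, hρ, ha]
    field_simp
    ring
  have c0 : ContDiff ℝ (⊤ : ℕ∞) fun y => ‖pd 0 u y‖ ^ 2 := (pd_contDiff 0 hu).norm_sq ℝ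
  have c1 : ContDiff ℝ (⊤ : ℕ∞) fun y => ‖pd 1 u y‖ ^ 2 := (pd_contDiff 1 hu).norm_sq ℝ
  have c2 : ContDiff ℝ (⊤ : ℕ∞) fun y => ‖ρ y‖ ^ 2 := hρc.norm_sq ℝ
  have hlape : lap (eDens ε u) x =
      (1 / 2) * (2 * inner ℝ (pd 0 u x) (lap (pd 0 u) x) + 2 * gradSqNorm (pd 0 u) x)
      + (1 / 2) * (2 * inner ℝ (pd 1 u x) (lap (pd 1 u) x) + 2 * gradSqNorm (pd 1 u) x)
      + (a / 4) * (2 * (ρ x * lap ρ x) + 2 * gradSqNorm ρ x) := by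
    rw [hdec, lap_add ((csm _ c0).add (csm _ c1))
      (csm _ c2), lap_add (csm _ c0) (csm _ c1),
      lap_const_smul _ c0, lap_const_smul _ c1, lap_const_smul _ c2,
      lap_normSq (pd_contDiff 0 hu), lap_normSq (pd_contDiff 1 hu), lap_normSq hρc]
    simp only [smul_eq_mul]
    rw [real_inner_eq_re_inner, RCLike.inner_apply]
    simp [mul_comm]
  have hg0 : 0 ≤ gradSqNorm (pd 0 u) x := by unfold gradSqNorm; positivity
  have hg1 : 0 ≤ gradSqNorm (pd 1 u) x := by unfold gradSqNorm; positivity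
  have hG : 0 ≤ gradSqNorm u x := by unfold gradSqNorm; positivity
  have hgρ : gradSqNorm ρ x = pd 0 ρ x ^ 2 + pd 1 ρ x ^ 2 := by
    simp [gradSqNorm, Fin.sum_univ_two]
  have hGe : gradSqNorm u x = ‖pd 0 u x‖ ^ 2 + ‖pd 1 u x‖ ^ 2 := by
    simp [gradSqNorm, Fin.sum_univ_two]
  have hcore := algebra_core a (ρ x) (gradSqNorm u x) (‖u x‖ ^ 2) (eDens ε u x) ha0 hG
    (by positivity) (by simp [hρ, sub_eq_add_neg]) (by
      simp only [eDens, smul_eq_mul, hρ, ha]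
      field_simp
      ring)
  rw [hlape, hlapp, hlapp, hlapρ, hgρ]
  have p0 : 0 ≤ a * (pd 0 ρ x) ^ 2 := by positivity
  have p1 : 0 ≤ a * (pd 1 ρ x) ^ 2 := by positivity
  rw [hGe] at hcore ⊢
  nlinarith

end Bochner

section MeanValue

/-- weight -/
def etaF (y : E2) : ℝ := max (1 - ‖y‖ ^ 2) 0

/-- potential of the weight -/
def psiF (y : E2) : ℝ := (max (1 - ‖y‖ ^ 2) 0) ^ 2 / 4

lemma etaF_cont : Continuous etaF := by unfold etaF; fun_prop

lemma psiF_cont : Continuous psiF := by unfold psiF; fun_prop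

lemma etaF_nonneg (y : E2) : 0 ≤ etaF y := le_max_right _ _

lemma psiF_nonneg (y : E2) : 0 ≤ psiF y := by unfold psiF; positivity

lemma etaF_le_one (y : E2) : etaF y ≤ 1 := by
  unfold etaF; apply max_le <;> nlinarith [sq_nonneg ‖y‖]

lemma etaF_zero {y : E2} (hy : 1 ≤ ‖y‖) : etaF y = 0 := by
  unfold etaF; apply max_eq_right; nlinarith

lemma psiF_eq (y : E2) : psiF y = etaF y ^ 2 / 4 := rfl

lemma psiF_le (y : E2) : psiF y ≤ etaF y := by
  rw [psiF_eq]; nlinarith [etaF_nonneg y, etaF_le_one y]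

lemma etaF_supp : HasCompactSupport etaF :=
  HasCompactSupport.intro (isCompact_closedBall (0 : E2) 1) fun y hy => by
    apply etaF_zero
    simp at hy; exact hy.le

lemma psiF_supp : HasCompactSupport psiF :=
  HasCompactSupport.intro (isCompact_closedBall (0 : E2) 1) fun y hy => by
    rw [psiF_eq, etaF_zero]; · norm_num
    simp at hy; exact hy.le

lemma hasDerivAt_posSq (x : ℝ) : HasDerivAt (fun t : ℝ => (max t 0) ^ 2) (2 * max x 0) x := by
  rcases lt_trichotomy x 0 with h | h | h
  · rw [max_eq_right h.le, mul_zero]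
    apply (hasDerivAt_const x (0 : ℝ)).congr_of_eventuallyEq
    filter_upwards [gt_mem_nhds h] with t ht
    simp [max_eq_right ht.le]
  · subst h
    rw [hasDerivAt_iff_isLittleO]
    simp only [max_self, mul_zero, sub_zero, smul_zero]
    have h1 : (fun t : ℝ => (max t 0) ^ 2 - 0 ^ 2) =O[nhds 0] fun t : ℝ => t ^ 2 := by
      apply Asymptotics.isBigO_of_le
      intro t
      rw [Real.norm_eq_abs, Real.norm_eq_abs, abs_of_nonneg (by positivity : 0 ≤ t ^ 2),
        abs_of_nonneg (by rw [zero_pow two_ne_zero, sub_zero]; positivity)]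
      rcases le_total t 0 with h | h
      · simp [max_eq_right h]; positivity
      · simp [max_eq_left h]
    exact h1.trans_isLittleO (Asymptotics.isLittleO_pow_id one_lt_two)
  · rw [max_eq_left h.le]
    have := hasDerivAt_pow 2 x
    simp only [Nat.cast_ofNat, Nat.add_one_sub_one, pow_one] at this
    apply this.congr_of_eventuallyEq
    filter_upwards [lt_mem_nhds h] with t ht
    simp [max_eq_left ht.le]

lemma psiF_hasFDerivAt (y : E2) :
    HasFDerivAt psiF (-(etaF y) • innerSL ℝ y) y := by
  have h1 : HasFDerivAt (fun z : E2 => 1 - ‖z‖ ^ 2) (-(2 • innerSL ℝ y)) y :=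
    ((hasStrictFDerivAt_norm_sq y).hasFDerivAt).const_sub 1
  have h2 := ((hasDerivAt_posSq (1 - ‖y‖ ^ 2)).div_const 4).comp_hasFDerivAt y h1
  refine h2.congr_fderiv ?_
  ext v
  simp [etaF]; ring

lemma int_cs {f g : E2 → ℝ} (hf : Continuous f) (hg : Continuous g) (hs : HasCompactSupport g) :
    Integrable (fun y => f y * g y) :=
  (hf.mul hg).integrable_of_hasCompactSupport hs.mul_left

/-- derivative of the weighted mean -/
lemma mean_hasDerivAt {e : E2 → ℝ} (he : ContDiff ℝ (⊤ : ℕ∞) e) (x0 : E2) (t : ℝ) :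
    HasDerivAt (fun t : ℝ => ∫ y, e (x0 + t • y) * etaF y)
      (∫ y, fderiv ℝ e (x0 + t • y) y * etaF y) t := by
  have hfc : Continuous (fderiv ℝ e) := he.continuous_fderiv (by simp)
  have hjoint : Continuous (fun p : ℝ × E2 => fderiv ℝ e (x0 + p.1 • p.2) p.2) :=
    (hfc.comp (by fun_prop)).clm_apply continuous_snd
  obtain ⟨B, hB⟩ := ((isCompact_Icc (a := t - 1) (b := t + 1)).prod
    (isCompact_closedBall (0 : E2) 1)).exists_bound_of_continuousOn hjoint.continuousOn
  have hB0 : 0 ≤ B := (norm_nonneg _).trans (hB (t, 0) ⟨⟨by simp, by simp⟩, by simp⟩)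
  refine (hasDerivAt_integral_of_dominated_loc_of_deriv_le
    (F := fun (t : ℝ) (y : E2) => e (x0 + t • y) * etaF y)
    (F' := fun (t : ℝ) (y : E2) => fderiv ℝ e (x0 + t • y) y * etaF y)
    (bound := fun y => B * etaF y)
    (Icc_mem_nhds (sub_one_lt t) (lt_add_one t)) ?_ ?_ ?_ ?_ ?_ ?_).2
  · refine Filter.Eventually.of_forall fun s => ?_
    exact ((he.continuous.comp (by fun_prop)).mul etaF_cont).aestronglyMeasurable
  · exact int_cs (he.continuous.comp (by fun_prop)) etaF_cont etaF_supp
  · exact ((hjoint.comp (by fun_prop : Continuous fun y : E2 => (t, y))).mul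
      etaF_cont).aestronglyMeasurable
  · refine Filter.Eventually.of_forall fun y s hs => ?_
    rw [norm_mul, Real.norm_of_nonneg (etaF_nonneg y)]
    by_cases hy : ‖y‖ ≤ 1
    · exact mul_le_mul_of_nonneg_right (hB (s, y) ⟨hs, by simpa using hy⟩) (etaF_nonneg y)
    · rw [etaF_zero (not_le.1 hy).le]; simp
  · exact int_cs continuous_const etaF_cont etaF_supp
  · refine Filter.Eventually.of_forall fun y s _ => ?_
    have h1 : HasDerivAt (fun s : ℝ => x0 + s • y) y s := by
      simpa using ((hasDerivAt_id s).smul_const y).const_add x0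
    exact ((he.differentiable (by simp) _).hasFDerivAt.comp_hasDerivAt s h1).mul_const _

lemma mean_deriv_eq {e : E2 → ℝ} (he : ContDiff ℝ (⊤ : ℕ∞) e) (x0 : E2) (t : ℝ) :
    ∫ y, fderiv ℝ e (x0 + t • y) y * etaF y = t * ∫ y, lap e (x0 + t • y) * psiF y := by
  have hk : ∀ k : Fin 2, ∫ y, pd k e (x0 + t • y) * (y k * etaF y)
      = ∫ y, (t * pd k (pd k e) (x0 + t • y)) * psiF y := by
    intro k
    have hc := pd_contDiff k he
    have hcc := pd_contDiff k hc
    have hd : ∀ y : E2, HasFDerivAt (fun y : E2 => pd k e (x0 + t • y))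
        (t • fderiv ℝ (pd k e) (x0 + t • y)) y := by
      intro y
      have h1 : HasFDerivAt (fun y : E2 => x0 + t • y) (t • ContinuousLinearMap.id ℝ E2) y :=
        ((hasFDerivAt_id y).const_smul t).const_add x0
      refine ((hc.differentiable (by simp) _).hasFDerivAt.comp y h1).congr_fderiv ?_
      ext v; simp
    have hval : ∀ y : E2, (-(etaF y) • innerSL ℝ y) (EuclideanSpace.single k (1 : ℝ))
        = -(y k * etaF y) := by
      intro y; simp [EuclideanSpace.inner_single_right]; ring
    have hyk : Continuous fun y : E2 => y k := by fun_prop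
    have hc1 : Continuous fun y : E2 => pd k e (x0 + t • y) := hc.continuous.comp (by fun_prop)
    have hc2 : Continuous fun y : E2 => t * pd k (pd k e) (x0 + t • y) :=
      continuous_const.mul (hcc.continuous.comp (by fun_prop))
    have ibp := integral_bilinear_hasFDerivAt_right_eq_neg_left_of_integrable (μ := volume)
      (f := fun y : E2 => pd k e (x0 + t • y))
      (f' := fun y => t • fderiv ℝ (pd k e) (x0 + t • y))
      (g := psiF) (g' := fun y => -(etaF y) • innerSL ℝ y)
      (v := EuclideanSpace.single k (1 : ℝ)) (B := ContinuousLinearMap.mul ℝ ℝ)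
      (by
        simpa [pd] using int_cs hc2 psiF_cont psiF_supp)
      (by
        simp only [hval, ContinuousLinearMap.mul_apply']
        exact int_cs hc1 (hyk.mul etaF_cont).neg etaF_supp.mul_left.neg)
      (by simpa using int_cs hc1 psiF_cont psiF_supp)
      (fun y _ => hd y) (fun y _ => psiF_hasFDerivAt y)
    simp only [hval, ContinuousLinearMap.mul_apply'] at ibp
    simp only [mul_neg, integral_neg, neg_inj] at ibp
    rw [ibp]
    rfl
  have hexp : ∀ y : E2, fderiv ℝ e (x0 + t • y) y * etaF y
      = pd 0 e (x0 + t • y) * (y 0 * etaF y) + pd 1 e (x0 + t • y) * (y 1 * etaF y) := by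
    intro y
    have : y = y 0 • EuclideanSpace.single 0 (1 : ℝ) + y 1 • EuclideanSpace.single 1 (1 : ℝ) := by
      ext i; fin_cases i <;> simp
    have h2 : fderiv ℝ e (x0 + t • y) y = y 0 * pd 0 e (x0 + t • y) + y 1 * pd 1 e (x0 + t • y) := by
      unfold pd
      conv_lhs => rw [show (fderiv ℝ e (x0 + t • y)) y = (fderiv ℝ e (x0 + t • y)) 
        (y 0 • EuclideanSpace.single 0 (1 : ℝ) + y 1 • EuclideanSpace.single 1 (1 : ℝ)) from
          congrArg _ this]
      rw [map_add, map_smul, map_smul]; rfl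
    rw [h2]; ring
  have hi : ∀ k : Fin 2, Integrable fun y : E2 => pd k e (x0 + t • y) * (y k * etaF y) := fun k =>
    int_cs ((pd_contDiff k he).continuous.comp (by fun_prop))
      ((by fun_prop : Continuous fun y : E2 => y k).mul etaF_cont) etaF_supp.mul_left
  have hj : ∀ k : Fin 2, Integrable fun y : E2 => (t * pd k (pd k e) (x0 + t • y)) * psiF y :=
    fun k => int_cs (continuous_const.mul ((pd_contDiff k (pd_contDiff k he)).continuous.comp
      (by fun_prop))) psiF_cont psiF_supp
  simp_rw [hexp]
  rw [integral_add (hi 0) (hi 1), hk, hk, ← integral_add (hj 0) (hj 1), ← integral_const_mul]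
  congr 1; funext y; unfold lap; ring

/-- total mass -/
def cEta : ℝ := ∫ y, etaF y

lemma cEta_pos : 0 < cEta := by
  unfold cEta
  refine etaF_cont.integral_pos_of_hasCompactSupport_nonneg_nonzero etaF_supp etaF_nonneg
    (x := 0) ?_
  simp [etaF]

lemma mean_value {e : E2 → ℝ} (he : ContDiff ℝ (⊤ : ℕ∞) e) (he0 : ∀ x, 0 ≤ e x) (x0 : E2)
    {s l : ℝ} (hs : 0 < s) (hl : 0 ≤ l) (h : ∀ x ∈ ball x0 s, -l ≤ lap e x) :
    e x0 * cEta ≤ (s ^ 2)⁻¹ * (∫ y in ball x0 s, e y) + l * s ^ 2 / 2 * cEta := by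
  set M : ℝ → ℝ := fun t => ∫ y, e (x0 + t • y) * etaF y with hM
  have hlc : Continuous (lap e) := 
    ((pd_contDiff 0 (pd_contDiff 0 he)).add (pd_contDiff 1 (pd_contDiff 1 he))).continuous
  have hd : ∀ t : ℝ, HasDerivAt (fun t => M t + l * t ^ 2 / 2 * cEta)
      (t * (∫ y, lap e (x0 + t • y) * psiF y) + l * t * cEta) t := by
    intro t
    have h1 := mean_hasDerivAt he x0 t
    rw [mean_deriv_eq he] at h1
    have h2 : HasDerivAt (fun t : ℝ => l * t ^ 2 / 2 * cEta) (l * t * cEta) t := by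
      have := (((hasDerivAt_pow 2 t).const_mul l).div_const 2).mul_const cEta
      refine this.congr_deriv ?_
      norm_num
      left; ring
    exact h1.add h2
  have hmono : MonotoneOn (fun t => M t + l * t ^ 2 / 2 * cEta) (Set.Icc 0 s) := by
    apply monotoneOn_of_deriv_nonneg (convex_Icc 0 s)
    · exact fun t _ => (hd t).continuousAt.continuousWithinAt
    · exact fun t _ => (hd t).differentiableAt.differentiableWithinAt
    · intro t ht
      rw [interior_Icc] at ht
      rw [(hd t).deriv]
      have hint : -(l * cEta) ≤ ∫ y, lap e (x0 + t • y) * psiF y := by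
        unfold cEta
        rw [← integral_const_mul, ← integral_neg]
        apply integral_mono
        · exact (int_cs continuous_const etaF_cont etaF_supp).neg
        · exact int_cs (hlc.comp (by fun_prop)) psiF_cont psiF_supp
        · intro y
          show -(l * etaF y) ≤ lap e (x0 + t • y) * psiF y
          by_cases hy : ‖y‖ < 1
          · have hb := h (x0 + t • y) (by
              rw [mem_ball_iff_norm, add_sub_cancel_left, norm_smul, Real.norm_of_nonneg ht.1.le]
              nlinarith [ht.1, ht.2, norm_nonneg y])
            have := psiF_le y
            have := psiF_nonneg y
            nlinarith [mul_le_mul_of_nonneg_right hb this, mul_le_mul_of_nonneg_left (psiF_le y) hl]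
          · rw [psiF_eq, etaF_zero (not_lt.1 hy)]; simp
      nlinarith [mul_le_mul_of_nonneg_left hint ht.1.le]
  have h0 := hmono (Set.left_mem_Icc.2 hs.le) (Set.right_mem_Icc.2 hs.le) hs.le
  have hM0 : M 0 = e x0 * cEta := by
    simp only [hM, zero_smul, add_zero]
    rw [integral_const_mul]; rfl
  have hMs : M s ≤ (s ^ 2)⁻¹ * (∫ y in ball x0 s, e y) := by
    have hib : IntegrableOn e (ball x0 s) :=
      (he.continuous.continuousOn.integrableOn_compact (isCompact_closedBall x0 s)).mono_set
        ball_subset_closedBall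
    have hig : Integrable ((ball x0 s).indicator e) := hib.integrable_indicator measurableSet_ball
    have hcv : ∫ y, (ball x0 s).indicator e (x0 + s • y)
        = (s ^ 2)⁻¹ * (∫ y in ball x0 s, e y) := by
      have := Measure.integral_comp_smul_of_nonneg (volume : Measure E2)
        (fun z => (ball x0 s).indicator e (x0 + z)) s (hR := hs.le)
      rw [this, integral_add_left_eq_self (fun z => (ball x0 s).indicator e z) x0,
        integral_indicator measurableSet_ball]
      simp
    rw [← hcv]
    apply integral_mono
    · exact int_cs (he.continuous.comp (by fun_prop)) etaF_cont etaF_supp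
    · exact (hig.comp_add_left x0).comp_smul hs.ne'
    · intro y
      show e (x0 + s • y) * etaF y ≤ (ball x0 s).indicator e (x0 + s • y)
      by_cases hy : ‖y‖ < 1
      · rw [Set.indicator_of_mem]
        · nlinarith [he0 (x0 + s • y), etaF_le_one y, etaF_nonneg y]
        · rw [mem_ball_iff_norm, add_sub_cancel_left, norm_smul, Real.norm_of_nonneg hs.le]
          nlinarith
      · rw [etaF_zero (not_lt.1 hy), mul_zero]
        exact Set.indicator_nonneg (fun z _ => he0 z) _
  simp only [hM0] at h0
  norm_num at h0
  linarith

/-- Schoen's trick -/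
lemma schoen {e : E2 → ℝ} (he : ContDiff ℝ (⊤ : ℕ∞) e) (he0 : ∀ x, 0 ≤ e x) {r : ℝ} (hr : 0 < r)
    (hlap : ∀ x ∈ ball (0 : E2) r, -(32 * e x ^ 2) ≤ lap e x)
    (hE : (∫ y in ball (0 : E2) r, e y) < cEta / 1024) :
    ∀ x ∈ ball (0 : E2) (r / 2),
      r ^ 2 * e x ≤ 32 / cEta * ∫ y in ball (0 : E2) r, e y := by
  intro x hx
  have hc := cEta_pos
  set E := ∫ y in ball (0 : E2) r, e y with hEdef
  have hE0 : 0 ≤ E := integral_nonneg he0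
  have hib : IntegrableOn e (ball (0 : E2) r) :=
    (he.continuous.continuousOn.integrableOn_compact (isCompact_closedBall (0 : E2) r)).mono_set
      ball_subset_closedBall
  obtain ⟨x0, hx0, hmax⟩ := (isCompact_closedBall (0 : E2) r).exists_isMaxOn
    ⟨0, by simp [hr.le]⟩ (f := fun z => (r - ‖z‖) ^ 2 * e z)
    (((by fun_prop : Continuous fun z : E2 => (r - ‖z‖) ^ 2).mul he.continuous).continuousOn)
  have hmax' : ∀ z ∈ closedBall (0 : E2) r, (r - ‖z‖) ^ 2 * e z ≤ (r - ‖x0‖) ^ 2 * e x0 := hmax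
  rw [mem_closedBall_zero_iff] at hx0
  rw [mem_ball_zero_iff] at hx
  -- it suffices to bound the maximum
  suffices hF : (r - ‖x0‖) ^ 2 * e x0 ≤ 8 * (E / cEta) by
    have h1 := hmax' x (by rw [mem_closedBall_zero_iff]; linarith)
    have h2 : (r / 2) ^ 2 * e x ≤ (r - ‖x‖) ^ 2 * e x := by
      apply mul_le_mul_of_nonneg_right _ (he0 x)
      apply pow_le_pow_left₀ (by linarith); linarith
    have : 32 / cEta * E = 32 * (E / cEta) := by ring
    rw [this]; nlinarith
  have hEc : 0 ≤ E / cEta := by positivity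
  by_cases hb : e x0 = 0 ∨ ‖x0‖ = r
  · rcases hb with hb | hb <;> rw [hb] <;> simp <;> positivity
  push Not at hb
  have hpos : 0 < e x0 := lt_of_le_of_ne (he0 x0) hb.1.symm
  set σ := (r - ‖x0‖) / 2 with hσ
  have hσ0 : 0 < σ := by
    have := lt_of_le_of_ne hx0 hb.2
    rw [hσ]; linarith
  have key : ∀ s, 0 < s → s ≤ σ → e x0 * s ^ 2 ≤ 1 / 512 → e x0 * s ^ 2 ≤ 2 * (E / cEta) := by
    intro s hs hsσ hsm
    have hsub : ball x0 s ⊆ ball (0 : E2) r := by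
      apply ball_subset_ball'
      rw [dist_zero_right]; linarith
    have hbd : ∀ z ∈ ball x0 s, e z ≤ 4 * e x0 := by
      intro z hz
      have hz1 := hsub hz
      rw [mem_ball_zero_iff] at hz1
      have h1 := hmax' z (by rw [mem_closedBall_zero_iff]; exact hz1.le)
      have hz2 : ‖z‖ ≤ ‖x0‖ + s := by
        rw [mem_ball_iff_norm] at hz
        have := norm_add_le x0 (z - x0)
        rw [add_sub_cancel] at this; linarith
      have h2 : σ ^ 2 * e z ≤ (r - ‖z‖) ^ 2 * e z := by
        apply mul_le_mul_of_nonneg_right _ (he0 z)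
        apply pow_le_pow_left₀ hσ0.le; linarith
      have h3 : (r - ‖x0‖) ^ 2 * e x0 = σ ^ 2 * (4 * e x0) := by rw [hσ]; ring
      exact le_of_mul_le_mul_left (by linarith) (by positivity : 0 < σ ^ 2)
    have hmv := mean_value he he0 x0 hs (l := 512 * e x0 ^ 2) (by positivity) (by
      intro z hz
      have h1 := hlap z (hsub hz)
      have h2 : e z ^ 2 ≤ (4 * e x0) ^ 2 := pow_le_pow_left₀ (he0 z) (hbd z hz) 2
      nlinarith)
    have hle : ∫ y in ball x0 s, e y ≤ E :=
      setIntegral_mono_set hib (Filter.Eventually.of_forall he0) hsub.eventuallyLE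
    have h1 : e x0 * s ^ 2 * cEta ≤ E + 256 * (e x0 * s ^ 2) ^ 2 * cEta := by
      have := mul_le_mul_of_nonneg_left hmv (by positivity : 0 ≤ s ^ 2)
      have e1 : s ^ 2 * ((s ^ 2)⁻¹ * (∫ y in ball x0 s, e y) 
          + 512 * e x0 ^ 2 * s ^ 2 / 2 * cEta)
          = (∫ y in ball x0 s, e y) + 256 * (e x0 * s ^ 2) ^ 2 * cEta := by
        field_simp
        ring
      rw [e1] at this
      linarith
    set q := e x0 * s ^ 2
    have hq : 0 ≤ q := by positivity
    rw [show 2 * (E / cEta) = (2 * E) / cEta by ring, le_div_iff₀ hc]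
    have h2 : q ^ 2 ≤ q * (1 / 512) := by nlinarith
    nlinarith [mul_le_mul_of_nonneg_right h2 hc.le]
  have hEc2 : 2 * (E / cEta) < 1 / 512 := by
    rw [show 2 * (E / cEta) = (2 * E) / cEta by ring, div_lt_iff₀ hc]; linarith
  by_cases hsm : e x0 * σ ^ 2 ≤ 1 / 512
  · have := key σ hσ0 le_rfl hsm
    have h3 : (r - ‖x0‖) ^ 2 * e x0 = 4 * (e x0 * σ ^ 2) := by rw [hσ]; ring
    linarith
  · exfalso
    push Not at hsm
    have hsq : Real.sqrt (1 / 512 / e x0) ^ 2 = 1 / 512 / e x0 := Real.sq_sqrt (by positivity)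
    have heq : e x0 * Real.sqrt (1 / 512 / e x0) ^ 2 = 1 / 512 := by rw [hsq]; field_simp
    have := key (Real.sqrt (1 / 512 / e x0)) (Real.sqrt_pos.2 (by positivity)) (by
      rw [Real.sqrt_le_left hσ0.le, div_le_iff₀ hpos]; linarith) heq.le
    linarith

end MeanValue

/-- small-energy regularity for Ginzburg–Landau critical points
(Proposition 1.2 of the paper). -/
theorem ginzburg_landau_small_energy_regularity
    (n : ℕ) (hn : 1 ≤ n) :
    ∃ δ₀ > (0 : ℝ), ∃ C > (0 : ℝ),
      ∀ (ε : ℝ), 0 < ε → ∀ (r : ℝ), 0 < r →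
      ∀ (u : E2 → EuclideanSpace ℝ (Fin (n + 1))),
        ContDiff ℝ (⊤ : ℕ∞) u →
        (∀ x ∈ ball (0 : E2) r,
          -lap u x = ((1 / ε ^ 2) * (1 - ‖u x‖ ^ 2)) • u x) →
        (∫ x in ball (0 : E2) r, eDens ε u x) < δ₀ →
        ∀ x ∈ ball (0 : E2) (r / 2),
          r ^ 2 * (gradSqNorm u x + (1 / ε ^ 2) * (1 - ‖u x‖ ^ 2) ^ 2)
            ≤ C * ∫ y in ball (0 : E2) r, eDens ε u y := by
  have hc := cEta_pos
  refine ⟨cEta / 1024, by positivity, 128 / cEta, by positivity, ?_⟩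
  intro ε hε r hr u hu heq hE x hx
  have key := schoen (eDens_contDiff ε hu) (eDens_nonneg ε u) hr (fun z hz =>
    bochner ε hε hu z (by
      filter_upwards [isOpen_ball.mem_nhds hz] with y hy using heq y hy)) hE x hx
  have h4 : gradSqNorm u x + (1 / ε ^ 2) * (1 - ‖u x‖ ^ 2) ^ 2 ≤ 4 * eDens ε u x := by
    have hG : 0 ≤ gradSqNorm u x := by unfold gradSqNorm; positivity
    have : 4 * eDens ε u x = 2 * gradSqNorm u x + (1 / ε ^ 2) * (1 - ‖u x‖ ^ 2) ^ 2 := by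
      unfold eDens; field_simp; ring
    linarith
  have h5 := mul_le_mul_of_nonneg_left h4 (by positivity : 0 ≤ r ^ 2)
  have h6 : 128 / cEta * (∫ y in ball (0 : E2) r, eDens ε u y)
      = 4 * (32 / cEta * ∫ y in ball (0 : E2) r, eDens ε u y) := by ring
  rw [h6]
  linarith
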